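/- Let Z be standard normal, h: ℝ → ℝ bounded and continuous, and let f_h(w) = −e^{w²/2} ∫_w^∞ e^{−t²/2}(h(t) − E h(Z)) dt be the solution of the Stein equation. Then f_h is bounded with sup_w |f_h(w)| ≤ √(2πe)·sup_w |h(w)| and sup_w |f_h'(w)| ≤ 4·sup_w |h(w)|. -/

import Mathlib

open MeasureTheory ProbabilityTheory Real

lemma integrable_exp_neg_sq_div_two : Integrable (fun t : ℝ => Real.exp (-(t ^ 2) / 2)) := by
  refine (integrable_exp_neg_mul_sq (b := 1 / 2) (by norm_num)).congr (.of_forall fun t => ?_)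
  simp only
  congr 1
  ring

lemma integral_Ioi_exp_neg_sq_div_two :
    ∫ t in Set.Ioi (0 : ℝ), Real.exp (-(t ^ 2) / 2) = Real.sqrt (2 * Real.pi) / 2 := by
  have h := integral_gaussian_Ioi (1 / 2)
  rw [show Real.pi / (1 / 2) = 2 * Real.pi by ring] at h
  rw [← h]
  congr 1 with t
  congr 1
  ring

lemma integral_exp_neg_sq_div_two :
    ∫ t : ℝ, Real.exp (-(t ^ 2) / 2) = Real.sqrt (2 * Real.pi) := by
  have h := integral_gaussian (1 / 2)
  rw [show Real.pi / (1 / 2) = 2 * Real.pi by ring] at h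
  rw [← h]
  congr 1 with t
  congr 1
  ring

lemma integrableOn_Ioi_mul_exp_neg_sq_div_two (w : ℝ) :
    IntegrableOn (fun t : ℝ => t * Real.exp (-(t ^ 2) / 2)) (Set.Ioi w) := by
  refine ((integrable_mul_exp_neg_mul_sq (b := 1 / 2) (by norm_num)).congr
    (.of_forall fun t => ?_)).integrableOn
  simp only
  congr 2
  ring

lemma integral_Ioi_mul_exp_neg_sq_div_two (w : ℝ) :
    ∫ t in Set.Ioi w, t * Real.exp (-(t ^ 2) / 2) = Real.exp (-(w ^ 2) / 2) := by
  have hderiv : ∀ x ∈ Set.Ici w, HasDerivAt (fun t : ℝ => -Real.exp (-(t ^ 2) / 2))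
      (x * Real.exp (-(x ^ 2) / 2)) x := by
    intro x _
    have := (((hasDerivAt_pow 2 x).neg.div_const 2).exp).neg
    refine this.congr_deriv ?_
    simp
    ring
  have hlim : Filter.Tendsto (fun t : ℝ => -Real.exp (-(t ^ 2) / 2)) Filter.atTop (nhds 0) := by
    rw [← neg_zero]
    refine (Real.tendsto_exp_atBot.comp ?_).neg
    have : Filter.Tendsto (fun t : ℝ => t ^ 2 / 2) Filter.atTop Filter.atTop :=
      (Filter.tendsto_pow_atTop two_ne_zero).atTop_div_const two_pos
    refine (Filter.tendsto_neg_atTop_atBot.comp this).congr fun t => ?_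
    simp [neg_div]
  rw [integral_Ioi_of_hasDerivAt_of_tendsto' hderiv
    (integrableOn_Ioi_mul_exp_neg_sq_div_two w) hlim]
  ring

/-- The upper Gaussian tail is at most `e^{-w²/2}` times half of the total Gaussian mass. -/
lemma exp_mul_integral_Ioi_exp_neg_sq_div_two_le {w : ℝ} (hw : 0 ≤ w) :
    Real.exp (w ^ 2 / 2) * ∫ t in Set.Ioi w, Real.exp (-(t ^ 2) / 2)
      ≤ Real.sqrt (2 * Real.pi) / 2 := by
  have hshift : ∫ t in Set.Ioi w, Real.exp (-(t ^ 2) / 2)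
      = ∫ t in Set.Ioi (0 : ℝ), Real.exp (-((t + w) ^ 2) / 2) := by
    have := (measurePreserving_add_right volume w).setIntegral_preimage_emb
      (measurableEmbedding_addRight w) (fun t : ℝ => Real.exp (-(t ^ 2) / 2)) (Set.Ioi w)
    rw [Set.preimage_add_const_Ioi, sub_self] at this
    exact this.symm
  rw [hshift, ← integral_Ioi_exp_neg_sq_div_two, ← integral_const_mul]
  refine setIntegral_mono_on
    ((integrable_exp_neg_sq_div_two.comp_add_right w).const_mul _).integrableOn
    integrable_exp_neg_sq_div_two.integrableOn measurableSet_Ioi fun t ht => ?_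
  rw [← Real.exp_add]
  refine Real.exp_le_exp.2 ?_
  nlinarith [mul_nonneg hw (Set.mem_Ioi.1 ht).le]

/-- The Mills ratio bound, in multiplicative form. -/
lemma mul_exp_mul_integral_Ioi_exp_neg_sq_div_two_le (w : ℝ) :
    w * (Real.exp (w ^ 2 / 2) * ∫ t in Set.Ioi w, Real.exp (-(t ^ 2) / 2)) ≤ 1 := by
  have hle : w * ∫ t in Set.Ioi w, Real.exp (-(t ^ 2) / 2) ≤ Real.exp (-(w ^ 2) / 2) := by
    rw [← integral_Ioi_mul_exp_neg_sq_div_two, ← integral_const_mul]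
    refine setIntegral_mono_on (integrable_exp_neg_sq_div_two.const_mul _).integrableOn
      (integrableOn_Ioi_mul_exp_neg_sq_div_two w) measurableSet_Ioi fun t ht => ?_
    exact mul_le_mul_of_nonneg_right (Set.mem_Ioi.1 ht).le (Real.exp_pos _).le
  calc w * (Real.exp (w ^ 2 / 2) * ∫ t in Set.Ioi w, Real.exp (-(t ^ 2) / 2))
      = Real.exp (w ^ 2 / 2) * (w * ∫ t in Set.Ioi w, Real.exp (-(t ^ 2) / 2)) := by ring
    _ ≤ Real.exp (w ^ 2 / 2) * Real.exp (-(w ^ 2) / 2) :=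
      mul_le_mul_of_nonneg_left hle (Real.exp_pos _).le
    _ = 1 := by rw [← Real.exp_add, neg_div, add_neg_cancel, Real.exp_zero]

lemma abs_integral_Ioi_exp_neg_sq_div_two_mul_le {k : ℝ → ℝ} {B : ℝ} (hk : ∀ t, |k t| ≤ B)
    (w : ℝ) :
    |∫ t in Set.Ioi w, Real.exp (-(t ^ 2) / 2) * k t|
      ≤ B * ∫ t in Set.Ioi w, Real.exp (-(t ^ 2) / 2) := by
  rw [← integral_const_mul, ← Real.norm_eq_abs]
  refine norm_integral_le_of_norm_le (integrable_exp_neg_sq_div_two.const_mul B).integrableOn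
    (.of_forall fun t => ?_)
  rw [norm_mul, Real.norm_eq_abs, Real.norm_eq_abs, Real.abs_exp, mul_comm]
  exact mul_le_mul_of_nonneg_right (hk t) (Real.exp_pos _).le

lemma abs_exp_mul_integral_Ioi_le {k : ℝ → ℝ} {B : ℝ} (hk : ∀ t, |k t| ≤ B)
    {w : ℝ} (hw : 0 ≤ w) :
    |Real.exp (w ^ 2 / 2) * ∫ t in Set.Ioi w, Real.exp (-(t ^ 2) / 2) * k t|
        ≤ Real.sqrt (2 * Real.pi) / 2 * B ∧
      w * |Real.exp (w ^ 2 / 2) * ∫ t in Set.Ioi w, Real.exp (-(t ^ 2) / 2) * k t| ≤ B := by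
  have hB : 0 ≤ B := (abs_nonneg _).trans (hk 0)
  have hle : |Real.exp (w ^ 2 / 2) * ∫ t in Set.Ioi w, Real.exp (-(t ^ 2) / 2) * k t|
      ≤ (Real.exp (w ^ 2 / 2) * ∫ t in Set.Ioi w, Real.exp (-(t ^ 2) / 2)) * B := by
    rw [abs_mul, Real.abs_exp, mul_assoc, mul_comm _ B]
    exact mul_le_mul_of_nonneg_left (abs_integral_Ioi_exp_neg_sq_div_two_mul_le hk w)
      (Real.exp_pos _).le
  refine ⟨hle.trans (mul_le_mul_of_nonneg_right
    (exp_mul_integral_Ioi_exp_neg_sq_div_two_le hw) hB), ?_⟩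
  refine (mul_le_mul_of_nonneg_left hle hw).trans ?_
  rw [← mul_assoc]
  exact mul_le_of_le_one_left hB (mul_exp_mul_integral_Ioi_exp_neg_sq_div_two_le w)

/-- For a weight-centred bounded `k`, the two-sided version of `abs_exp_mul_integral_Ioi_le`. -/
lemma abs_exp_mul_integral_Ioi_le_of_integral_eq_zero {k : ℝ → ℝ} {B : ℝ} (hk : ∀ t, |k t| ≤ B)
    (h_int : Integrable (fun t => Real.exp (-(t ^ 2) / 2) * k t))
    (hzero : ∫ t, Real.exp (-(t ^ 2) / 2) * k t = 0) (w : ℝ) :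
    |Real.exp (w ^ 2 / 2) * ∫ t in Set.Ioi w, Real.exp (-(t ^ 2) / 2) * k t|
        ≤ Real.sqrt (2 * Real.pi) / 2 * B ∧
      |w| * |Real.exp (w ^ 2 / 2) * ∫ t in Set.Ioi w, Real.exp (-(t ^ 2) / 2) * k t| ≤ B := by
  rcases le_total 0 w with hw | hw
  · rw [abs_of_nonneg hw]
    exact abs_exp_mul_integral_Ioi_le hk hw
  · have hsplit := intervalIntegral.integral_Iic_add_Ioi (b := w) h_int.integrableOn
      h_int.integrableOn
    have hreflect := integral_comp_neg_Iic w fun t => Real.exp (-(t ^ 2) / 2) * k (-t)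
    simp only [neg_sq, neg_neg] at hreflect
    have hneg : ∫ t in Set.Ioi w, Real.exp (-(t ^ 2) / 2) * k t
        = -∫ t in Set.Ioi (-w), Real.exp (-(t ^ 2) / 2) * k (-t) := by
      linarith
    have hbound := abs_exp_mul_integral_Ioi_le (fun t => hk (-t)) (neg_nonneg.2 hw)
    rw [neg_sq] at hbound
    rw [abs_of_nonpos hw, hneg, mul_neg, abs_neg]
    exact hbound

lemma hasDerivAt_integral_Ioi {g : ℝ → ℝ} (hg : Continuous g) (h_int : Integrable g) (w : ℝ) :
    HasDerivAt (fun x => ∫ t in Set.Ioi x, g t) (-g w) w := by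
  have heq : (fun x => ∫ t in Set.Ioi x, g t)
      = fun x => (∫ t in Set.Ioi (0 : ℝ), g t) - ∫ t in (0 : ℝ)..x, g t := by
    funext x
    have := intervalIntegral.integral_interval_add_Ioi' (a := 0) (b := x)
      h_int.intervalIntegrable h_int.integrableOn
    linarith
  rw [heq]
  exact (hg.integral_hasStrictDerivAt 0 w).hasDerivAt.const_sub _

lemma integral_gaussianReal_zero_one (h : ℝ → ℝ) :
    Real.sqrt (2 * Real.pi) * ∫ t, h t ∂(gaussianReal 0 1)
      = ∫ t, Real.exp (-(t ^ 2) / 2) * h t := by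
  have hpos : Real.sqrt (2 * Real.pi) ≠ 0 := by positivity
  rw [integral_gaussianReal_eq_integral_smul one_ne_zero, ← integral_const_mul]
  congr 1 with t
  simp only [gaussianPDFReal, NNReal.coe_one, mul_one, sub_zero, smul_eq_mul]
  field_simp

/-- Bounds for the solution of the Stein equation: for bounded continuous `h`,
the solution `f_h(w) = -e^{w²/2} ∫_w^∞ e^{-t²/2}(h t - E h(Z)) dt` satisfies
`‖f_h‖_∞ ≤ √(2πe) ‖h‖_∞` and `‖f_h'‖_∞ ≤ 4 ‖h‖_∞`. -/
theorem stein_equation_solution_bounds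
    (h : ℝ → ℝ) (hcont : Continuous h)
    (C : ℝ) (hbdd : ∀ x, |h x| ≤ C)
    (m : ℝ) (hm : m = ∫ t, h t ∂(gaussianReal 0 1))
    (f : ℝ → ℝ)
    (hf : ∀ w, f w =
      -(Real.exp (w ^ 2 / 2)) * ∫ t in Set.Ioi w, Real.exp (-(t ^ 2) / 2) * (h t - m)) :
    (∀ w, |f w| ≤ Real.sqrt (2 * Real.pi * Real.exp 1) * C) ∧
      (∀ w, |deriv f w| ≤ 4 * C) := by
  have hC : 0 ≤ C := (abs_nonneg _).trans (hbdd 0)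
  have hmC : |m| ≤ C := by
    rw [hm, ← Real.norm_eq_abs]
    have := norm_integral_le_of_norm_le_const (μ := gaussianReal 0 1) (f := h) (C := C)
      (.of_forall hbdd)
    simpa using this
  have hk : ∀ t, |h t - m| ≤ 2 * C := fun t =>
    (abs_sub _ _).trans (by linarith [hbdd t])
  have hh_int : Integrable (fun t => Real.exp (-(t ^ 2) / 2) * h t) :=
    integrable_exp_neg_sq_div_two.mul_bdd hcont.aestronglyMeasurable (.of_forall hbdd)
  have h_int : Integrable (fun t => Real.exp (-(t ^ 2) / 2) * (h t - m)) :=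
    integrable_exp_neg_sq_div_two.mul_bdd (hcont.sub continuous_const).aestronglyMeasurable
      (.of_forall hk)
  have hzero : ∫ t, Real.exp (-(t ^ 2) / 2) * (h t - m) = 0 := by
    simp only [mul_sub]
    rw [integral_sub hh_int (integrable_exp_neg_sq_div_two.mul_const m), integral_mul_const,
      integral_exp_neg_sq_div_two, ← integral_gaussianReal_zero_one, ← hm, sub_self]
  have hbound := abs_exp_mul_integral_Ioi_le_of_integral_eq_zero hk h_int hzero
  have habs : ∀ w, |f w|
      = |Real.exp (w ^ 2 / 2) * ∫ t in Set.Ioi w, Real.exp (-(t ^ 2) / 2) * (h t - m)| :=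
    fun w => by rw [hf, neg_mul, abs_neg]
  refine ⟨fun w => ?_, fun w => ?_⟩
  · rw [habs]
    calc _ ≤ Real.sqrt (2 * Real.pi) / 2 * (2 * C) := (hbound w).1
      _ = Real.sqrt (2 * Real.pi) * C := by ring
      _ ≤ _ := by
        refine mul_le_mul_of_nonneg_right (Real.sqrt_le_sqrt ?_) hC
        exact le_mul_of_one_le_right (by positivity) (Real.one_le_exp zero_le_one)
  · have hderiv : HasDerivAt f (w * f w + (h w - m)) w := by
      have hexp : HasDerivAt (fun x : ℝ => -Real.exp (x ^ 2 / 2)) (-(Real.exp (w ^ 2 / 2) * w)) w :=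
        ((((hasDerivAt_pow 2 w).div_const 2).exp).neg).congr_deriv (by simp)
      have hprod := hexp.mul (hasDerivAt_integral_Ioi (by fun_prop) h_int w)
      rw [show f = _ from funext hf]
      refine hprod.congr_deriv ?_
      have hcancel : Real.exp (w ^ 2 / 2) * Real.exp (-(w ^ 2) / 2) = 1 := by
        rw [← Real.exp_add, neg_div, add_neg_cancel, Real.exp_zero]
      linear_combination (h w - m) * hcancel
    have hwf : |w * f w| ≤ 2 * C := by
      rw [abs_mul, habs]
      exact (hbound w).2
    rw [hderiv.deriv]
    exact (abs_add_le _ _).trans (by linarith [hk w])
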